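/- Let n = 2(k+m+2) and let S and d be as in the context. Let R = ℝ[x_{ab} : 1 ≤ a < b ≤ n] be the polynomial ring in the above-diagonal matrix entries (the coordinate ring of UT(n,ℝ)), regard d as an element of R, and let R' be the localization of R at the powers of d. Every element of S lies in R' (each denominator Δ(c) is a product of factors of d, hence invertible in R'). Then the ideal I' of R' generated by S is a prime ideal. -/

import Mathlib

open Matrix

noncomputable section

/-- The coordinate ring `R = ℝ[x_{ab} : 1 ≤ a < b ≤ n]` of the group `UT(n,ℝ)`. -/
abbrev CoordRing (n : ℕ) := MvPolynomial {p : Fin n × Fin n // p.1 < p.2} ℝ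

/-- The generic unitriangular matrix, whose above-diagonal entries are the variables
`x_{ab}`, with `1`'s on the diagonal and `0`'s below. -/
def genMat (n : ℕ) : Matrix (Fin n) (Fin n) (CoordRing n) :=
  Matrix.of fun i j =>
    if h : i < j then MvPolynomial.X ⟨(i, j), h⟩ else if i = j then 1 else 0

section Indices

variable (k m : ℕ)

/-- Rows (and columns) of block `1` in the partition `(m,1,1,k,k,1,1,m)` of `n = 2(k+m+2)`. -/
def r1 (a : Fin m) : Fin (2*(k+m+2)) := ⟨a.val, by have := a.isLt; omega⟩
/-- The row/column of the `1×1` block `2`. -/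
def i2 : Fin (2*(k+m+2)) := ⟨m, by omega⟩
/-- The row/column of the `1×1` block `3`. -/
def i3 : Fin (2*(k+m+2)) := ⟨m+1, by omega⟩
/-- Rows (and columns) of block `4`. -/
def r4 (a : Fin k) : Fin (2*(k+m+2)) := ⟨m+2+a.val, by have := a.isLt; omega⟩
/-- Rows (and columns) of block `5`. -/
def c5 (a : Fin k) : Fin (2*(k+m+2)) := ⟨m+k+2+a.val, by have := a.isLt; omega⟩
/-- The row/column of the `1×1` block `6`. -/
def i6 : Fin (2*(k+m+2)) := ⟨m+2*k+2, by omega⟩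
/-- The row/column of the `1×1` block `7`. -/
def i7 : Fin (2*(k+m+2)) := ⟨m+2*k+3, by omega⟩
/-- Rows (and columns) of block `8`. -/
def c8 (a : Fin m) : Fin (2*(k+m+2)) := ⟨m+2*k+4+a.val, by have := a.isLt; omega⟩

/-- The polynomial `d = C₂₃ · det C₄₅ · C₆₇`. -/
def dPoly : CoordRing (2*(k+m+2)) :=
  genMat (2*(k+m+2)) (i2 k m) (i3 k m)
    * ((genMat (2*(k+m+2))).submatrix (r4 k m) (c5 k m)).det
    * genMat (2*(k+m+2)) (i6 k m) (i7 k m)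

/-- `R'`, the localization of the coordinate ring at the powers of `d`. -/
abbrev LocRing := Localization.Away (dPoly k m)

/-- The canonical map `R → R'`. -/
def toLoc : CoordRing (2*(k+m+2)) →+* LocRing k m := algebraMap _ _

/-- The set `S = S₀ ∪ S₁ ∪ S₂`, viewed inside the localization `R'`; the elements of `S₁`
are `c̃ = ±Δ(c)⁻¹·Δ̃(c)`, the denominators `Δ(c)` being invertible in `R'`. -/
def SPoly (γ₁ γ₂ : ℝ) : Set (LocRing k m) :=
  -- S₀ : strictly-above-diagonal entries of the diagonal blocks (1,1), (4,4), (5,5), (8,8)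
  {x | ∃ a b : Fin m, a < b ∧ x = toLoc k m (genMat (2*(k+m+2)) (r1 k m a) (r1 k m b))} ∪
  {x | ∃ a b : Fin k, a < b ∧ x = toLoc k m (genMat (2*(k+m+2)) (r4 k m a) (r4 k m b))} ∪
  {x | ∃ a b : Fin k, a < b ∧ x = toLoc k m (genMat (2*(k+m+2)) (c5 k m a) (c5 k m b))} ∪
  {x | ∃ a b : Fin m, a < b ∧ x = toLoc k m (genMat (2*(k+m+2)) (c8 k m a) (c8 k m b))} ∪
  -- S₁ : block (1,2), Φ(c) = ∅
  (Set.range fun a : Fin m => toLoc k m (genMat (2*(k+m+2)) (r1 k m a) (i2 k m))) ∪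
  -- S₁ : block (1,4), Φ(c) = {(2,3)}
  (Set.range fun p : Fin m × Fin k =>
    - Ring.inverse (toLoc k m (genMat (2*(k+m+2)) (i2 k m) (i3 k m)))
      * toLoc k m ((genMat (2*(k+m+2))).submatrix
          ![r1 k m p.1, i2 k m] ![i3 k m, r4 k m p.2]).det) ∪
  -- S₁ : block (1,6), Φ(c) = {(2,3),(4,5)}
  (Set.range fun a : Fin m =>
    (-1 : LocRing k m)^(k+1)
      * Ring.inverse (toLoc k m ((genMat (2*(k+m+2))).submatrix
          (Fin.cons (i2 k m) (r4 k m)) (Fin.cons (i3 k m) (c5 k m))).det)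
      * toLoc k m ((genMat (2*(k+m+2))).submatrix
          (Fin.cons (r1 k m a) (Fin.cons (i2 k m) (r4 k m)))
          (Fin.snoc (Fin.cons (i3 k m) (c5 k m)) (i6 k m))).det) ∪
  -- S₁ : block (3,4), Φ(c) = ∅
  (Set.range fun b : Fin k => toLoc k m (genMat (2*(k+m+2)) (i3 k m) (r4 k m b))) ∪
  -- S₁ : block (3,6), Φ(c) = {(4,5)}
  {(-1 : LocRing k m)^k
    * Ring.inverse (toLoc k m ((genMat (2*(k+m+2))).submatrix (r4 k m) (c5 k m)).det)
    * toLoc k m ((genMat (2*(k+m+2))).submatrix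
        (Fin.cons (i3 k m) (r4 k m)) (Fin.snoc (c5 k m) (i6 k m))).det} ∪
  -- S₁ : block (3,8), Φ(c) = {(4,5),(6,7)}
  (Set.range fun b : Fin m =>
    (-1 : LocRing k m)^(k+1)
      * Ring.inverse (toLoc k m ((genMat (2*(k+m+2))).submatrix
          (Fin.snoc (r4 k m) (i6 k m)) (Fin.snoc (c5 k m) (i7 k m))).det)
      * toLoc k m ((genMat (2*(k+m+2))).submatrix
          (Fin.cons (i3 k m) (Fin.snoc (r4 k m) (i6 k m)))
          (Fin.snoc (Fin.snoc (c5 k m) (i7 k m)) (c8 k m b))).det) ∪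
  -- S₁ : block (5,6), Φ(c) = ∅
  (Set.range fun a : Fin k => toLoc k m (genMat (2*(k+m+2)) (c5 k m a) (i6 k m))) ∪
  -- S₁ : block (5,8), Φ(c) = {(6,7)}
  (Set.range fun p : Fin k × Fin m =>
    - Ring.inverse (toLoc k m (genMat (2*(k+m+2)) (i6 k m) (i7 k m)))
      * toLoc k m ((genMat (2*(k+m+2))).submatrix
          ![c5 k m p.1, i6 k m] ![i7 k m, c8 k m p.2]).det) ∪
  -- S₁ : block (7,8), Φ(c) = ∅
  (Set.range fun b : Fin m => toLoc k m (genMat (2*(k+m+2)) (i7 k m) (c8 k m b))) ∪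
  -- S₂ : entries of C₂₃C₃₅ + C₂₄C₄₅
  (Set.range fun b : Fin k => toLoc k m
    (genMat (2*(k+m+2)) (i2 k m) (i3 k m) * genMat (2*(k+m+2)) (i3 k m) (c5 k m b)
      + ∑ t : Fin k,
          genMat (2*(k+m+2)) (i2 k m) (r4 k m t) * genMat (2*(k+m+2)) (r4 k m t) (c5 k m b))) ∪
  -- S₂ : entries of C₄₅C₅₇ + C₄₆C₆₇
  (Set.range fun a : Fin k => toLoc k m
    ((∑ t : Fin k,
        genMat (2*(k+m+2)) (r4 k m a) (c5 k m t) * genMat (2*(k+m+2)) (c5 k m t) (i7 k m))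
      + genMat (2*(k+m+2)) (r4 k m a) (i6 k m) * genMat (2*(k+m+2)) (i6 k m) (i7 k m))) ∪
  -- S₂ : γ₁C₂₃ − γ₂C₆₇
  {toLoc k m (MvPolynomial.C γ₁ * genMat (2*(k+m+2)) (i2 k m) (i3 k m)
      - MvPolynomial.C γ₂ * genMat (2*(k+m+2)) (i6 k m) (i7 k m))}

end Indices

section BorderedMinor

variable {A B ι : Type*} [CommRing A] [CommRing B]

theorem map_ringInverse_of_isUnit (f : A →+* B) {x : A} (hx : IsUnit x) :
    f (Ring.inverse x) = Ring.inverse (f x) := by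
  obtain ⟨u, rfl⟩ := hx
  have h : f (u : A) = ((Units.map (f : A →* B) u : Bˣ) : B) := rfl
  rw [h, Ring.inverse_unit, Ring.inverse_unit]
  rfl

/-- The normalised bordered minor `(-1)^N Δ⁻¹ Δ̃`, where `Δ` has rows `R` and columns `C`, and
`Δ̃` is obtained from `Δ` by adjoining the row `r` on top and the column `c` on the right. -/
def borderedMinor {N : ℕ} (M : Matrix ι ι A) (r : ι) (R C : Fin N → ι) (c : ι) : A :=
  (-1) ^ N * Ring.inverse (M.submatrix R C).det
    * (M.submatrix (Fin.cons r R : Fin (N + 1) → ι) (Fin.snoc C c : Fin (N + 1) → ι)).det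

theorem map_borderedMinor {N : ℕ} (f : A →+* B) (M : Matrix ι ι A) (r : ι) (R C : Fin N → ι)
    (c : ι) (h : IsUnit (M.submatrix R C).det) :
    f (borderedMinor M r R C c) = borderedMinor (M.map f) r R C c := by
  simp only [borderedMinor, map_mul, map_pow, map_neg, map_one, map_ringInverse_of_isUnit f h,
    RingHom.map_det]
  rfl

/-- The normalised bordered minor is the corner entry plus a term that does not depend on it. -/
theorem borderedMinor_sub_borderedMinor {N : ℕ} (M M' : Matrix ι ι A) (r : ι)
    (R C : Fin N → ι) (c : ι) (h : IsUnit (M.submatrix R C).det)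
    (hRC : ∀ i j, M (R i) (C j) = M' (R i) (C j)) (hr : ∀ j, M r (C j) = M' r (C j))
    (hc : ∀ i, M (R i) c = M' (R i) c) :
    borderedMinor M r R C c - borderedMinor M' r R C c = M r c - M' r c := by
  have hD : M'.submatrix R C = M.submatrix R C := by
    ext i j; exact (hRC i j).symm
  have key : ∀ L : Matrix ι ι A,
      (L.submatrix (Fin.cons r R : Fin (N + 1) → ι) (Fin.snoc C c : Fin (N + 1) → ι)).det
      = (∑ j : Fin N, (-1) ^ (j : ℕ) * L r (C j) * ((L.submatrix R
          (Fin.snoc C c : Fin (N + 1) → ι)).submatrix id (j.castSucc.succAbove)).det)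
        + (-1) ^ N * L r c * (L.submatrix R C).det := by
    intro L
    have h1 : (Fin.snoc C c : Fin (N + 1) → ι) ∘ Fin.castSucc = C := by
      ext j; simp
    rw [Matrix.det_succ_row_zero, Fin.sum_univ_castSucc]
    simp [Matrix.submatrix_submatrix, Fin.succAbove_last, h1, Function.comp_def]
  have hR : M'.submatrix R (Fin.snoc C c : Fin (N + 1) → ι)
      = M.submatrix R (Fin.snoc C c : Fin (N + 1) → ι) := by
    ext i j
    refine Fin.lastCases ?_ (fun j => ?_) j
    · simpa using (hc i).symm
    · simpa using (hRC i j).symm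
  have hu := Ring.inverse_mul_cancel _ h
  have hs : ((-1 : A) ^ N) * (-1) ^ N = 1 := by
    rw [← mul_pow]; simp
  simp only [borderedMinor, key, hR, hD, hr]
  linear_combination (M r c - M' r c) * hs
    + (M r c - M' r c) * ((-1 : A) ^ N * (-1) ^ N) * hu

theorem det_submatrix_cons_cons {N : ℕ} (M : Matrix ι ι A) (r c : ι) (R C : Fin N → ι)
    (h : ∀ i, M (R i) c = 0) :
    (M.submatrix (Fin.cons r R : Fin (N + 1) → ι) (Fin.cons c C : Fin (N + 1) → ι)).det
      = M r c * (M.submatrix R C).det := by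
  rw [Matrix.det_succ_column_zero, Fin.sum_univ_succ]
  simp [h, Matrix.submatrix_submatrix, Function.comp_def]

theorem det_submatrix_snoc_snoc {N : ℕ} (M : Matrix ι ι A) (r c : ι) (R C : Fin N → ι)
    (h : ∀ j, M r (C j) = 0) :
    (M.submatrix (Fin.snoc R r : Fin (N + 1) → ι) (Fin.snoc C c : Fin (N + 1) → ι)).det
      = (M.submatrix R C).det * M r c := by
  rw [Matrix.det_succ_row _ (Fin.last N), Fin.sum_univ_castSucc]
  simp [h, Matrix.submatrix_submatrix, Function.comp_def, Fin.succAbove_last, ← two_mul,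
    mul_comm]

theorem neg_inverse_mul_det_fin_two (M : Matrix ι ι A) (r i j c : ι) :
    - Ring.inverse (M i j) * (M.submatrix ![r, i] ![j, c]).det
      = borderedMinor M r ![i] ![j] c := by
  have h : (Fin.snoc ![j] c : Fin 2 → ι) = ![j, c] := by
    ext x; fin_cases x <;> rfl
  have h' : (Fin.cons r ![i] : Fin 2 → ι) = ![r, i] := rfl
  rw [borderedMinor, h, h', Matrix.det_fin_one]
  simp

end BorderedMinor

/-- Row and column indices, sorted by block. -/
inductive BlockIdx (k m : ℕ) : Type
  | b1 (a : Fin m) | b2 | b3 | b4 (a : Fin k) | b5 (a : Fin k) | b6 | b7 | b8 (a : Fin m)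

namespace BlockIdx

variable {k m : ℕ}

/-- The position of a block index. -/
def toFin : BlockIdx k m → Fin (2*(k+m+2))
  | b1 a => r1 k m a
  | b2 => i2 k m
  | b3 => i3 k m
  | b4 a => r4 k m a
  | b5 a => c5 k m a
  | b6 => i6 k m
  | b7 => i7 k m
  | b8 a => c8 k m a

theorem toFin_bijective : Function.Bijective (toFin : BlockIdx k m → _) := by
  constructor
  · rintro (a | _ | _ | a | a | _ | _ | a) (b | _ | _ | b | b | _ | _ | b) h <;>
      simp only [toFin, r1, i2, i3, r4, c5, i6, i7, c8, Fin.ext_iff] at h <;>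
      first
      | rfl
      | (congr 1; ext; omega)
      | (exfalso; omega)
  · rintro ⟨x, hx⟩
    by_cases h1 : x < m
    · exact ⟨b1 ⟨x, h1⟩, rfl⟩
    by_cases h2 : x = m
    · exact ⟨b2, Fin.ext h2.symm⟩
    by_cases h3 : x = m + 1
    · exact ⟨b3, Fin.ext h3.symm⟩
    by_cases h4 : x < m + 2 + k
    · exact ⟨b4 ⟨x - (m + 2), by omega⟩, Fin.ext (by simp only [toFin, r4]; omega)⟩
    by_cases h5 : x < m + k + 2 + k
    · exact ⟨b5 ⟨x - (m + k + 2), by omega⟩, Fin.ext (by simp only [toFin, c5]; omega)⟩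
    by_cases h6 : x = m + 2 * k + 2
    · exact ⟨b6, Fin.ext h6.symm⟩
    by_cases h7 : x = m + 2 * k + 3
    · exact ⟨b7, Fin.ext h7.symm⟩
    · exact ⟨b8 ⟨x - (m + 2 * k + 4), by omega⟩, Fin.ext (by simp only [toFin, c8]; omega)⟩

/-- Block indices and positions correspond bijectively. -/
def equivFin : BlockIdx k m ≃ Fin (2*(k+m+2)) := Equiv.ofBijective toFin toFin_bijective

end BlockIdx

open BlockIdx

section Elimination

variable {k m : ℕ} {A B : Type*} [CommRing A] [CommRing B]

/-- The conditions imposed by `S` on a matrix, with `g` in the place of `γ₁ / γ₂`. -/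
structure SatisfiesS (g : A) (M : Matrix (BlockIdx k m) (BlockIdx k m) A) : Prop where
  h11 : ∀ a b : Fin m, a < b → M (b1 a) (b1 b) = 0
  h44 : ∀ a b : Fin k, a < b → M (b4 a) (b4 b) = 0
  h55 : ∀ a b : Fin k, a < b → M (b5 a) (b5 b) = 0
  h88 : ∀ a b : Fin m, a < b → M (b8 a) (b8 b) = 0
  h12 : ∀ a, M (b1 a) b2 = 0
  h14 : ∀ a b, borderedMinor M (b1 a) ![b2] ![b3] (b4 b) = 0
  h16 : ∀ a, borderedMinor M (b1 a) (Fin.cons b2 b4 : Fin (k+1) → _)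
    (Fin.cons b3 b5 : Fin (k+1) → _) b6 = 0
  h34 : ∀ b, M b3 (b4 b) = 0
  h36 : borderedMinor M b3 b4 b5 b6 = 0
  h38 : ∀ b, borderedMinor M b3 (Fin.snoc b4 b6 : Fin (k+1) → _)
    (Fin.snoc b5 b7 : Fin (k+1) → _) (b8 b) = 0
  h56 : ∀ a, M (b5 a) b6 = 0
  h58 : ∀ a b, borderedMinor M (b5 a) ![b6] ![b7] (b8 b) = 0
  h78 : ∀ b, M b7 (b8 b) = 0
  h35 : ∀ b, M b2 b3 * M b3 (b5 b) + ∑ t, M b2 (b4 t) * M (b4 t) (b5 b) = 0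
  h57 : ∀ a, (∑ t, M (b4 a) (b5 t) * M (b5 t) b7) + M (b4 a) b6 * M b6 b7 = 0
  h67 : M b6 b7 = g * M b2 b3

/-- The first step of the elimination: all dependent entries except those in the blocks
`(1,4)`, `(1,6)`, `(3,6)`, `(3,8)` and `(5,8)` are expressed through the free entries. -/
def linearElim (g : A) (M : Matrix (BlockIdx k m) (BlockIdx k m) A) :
    Matrix (BlockIdx k m) (BlockIdx k m) A
  | b1 a, b1 b => if a < b then 0 else M (b1 a) (b1 b)
  | b4 a, b4 b => if a < b then 0 else M (b4 a) (b4 b)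
  | b5 a, b5 b => if a < b then 0 else M (b5 a) (b5 b)
  | b8 a, b8 b => if a < b then 0 else M (b8 a) (b8 b)
  | b1 _, b2 => 0
  | b3, b4 _ => 0
  | b5 _, b6 => 0
  | b7, b8 _ => 0
  | b3, b5 b => - Ring.inverse (M b2 b3) * ∑ t, M b2 (b4 t) * M (b4 t) (b5 b)
  | b5 a, b7 => - Ring.inverse (M.submatrix b4 b5).det
      * ((M.submatrix b4 b5).adjugate *ᵥ fun s => M (b4 s) b6 * (g * M b2 b3)) a
  | b6, b7 => g * M b2 b3
  | i, j => M i j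

/-- The matrix obtained from `M` by expressing all entries that are determined by `S` through
the remaining ones. -/
def elimS (g : A) (M : Matrix (BlockIdx k m) (BlockIdx k m) A) :
    Matrix (BlockIdx k m) (BlockIdx k m) A
  | b1 a, b4 b => M (b1 a) (b4 b) - borderedMinor (linearElim g M) (b1 a) ![b2] ![b3] (b4 b)
  | b1 a, b6 => M (b1 a) b6 - borderedMinor (linearElim g M) (b1 a)
      (Fin.cons b2 b4 : Fin (k+1) → _) (Fin.cons b3 b5 : Fin (k+1) → _) b6
  | b3, b6 => M b3 b6 - borderedMinor (linearElim g M) b3 b4 b5 b6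
  | b3, b8 b => M b3 (b8 b) - borderedMinor (linearElim g M) b3
      (Fin.snoc b4 b6 : Fin (k+1) → _) (Fin.snoc b5 b7 : Fin (k+1) → _) (b8 b)
  | b5 a, b8 b => M (b5 a) (b8 b) - borderedMinor (linearElim g M) (b5 a) ![b6] ![b7] (b8 b)
  | i, j => linearElim g M i j

variable {g : A} {M : Matrix (BlockIdx k m) (BlockIdx k m) A}

theorem linearElim_eq_self (hM : SatisfiesS g M) (h23 : IsUnit (M b2 b3))
    (h45 : IsUnit (M.submatrix b4 b5).det) : linearElim g M = M := by
  ext i j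
  unfold linearElim
  split
  · split_ifs with h
    · exact (hM.h11 _ _ h).symm
    · rfl
  · split_ifs with h
    · exact (hM.h44 _ _ h).symm
    · rfl
  · split_ifs with h
    · exact (hM.h55 _ _ h).symm
    · rfl
  · split_ifs with h
    · exact (hM.h88 _ _ h).symm
    · rfl
  · exact (hM.h12 _).symm
  · exact (hM.h34 _).symm
  · exact (hM.h56 _).symm
  · exact (hM.h78 _).symm
  · rename_i b
    linear_combination M b3 (b5 b) * Ring.inverse_mul_cancel _ h23
      - Ring.inverse (M b2 b3) * hM.h35 b
  · rename_i a
    have h : (M.submatrix b4 b5) *ᵥ (fun t => M (b5 t) b7)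
        = - fun s => M (b4 s) b6 * (g * M b2 b3) := by
      ext s
      rw [← hM.h67]
      exact eq_neg_of_add_eq_zero_left (hM.h57 s)
    have h' := congrArg (fun v => ((M.submatrix b4 b5).adjugate *ᵥ v) a) h
    simp only [Matrix.mulVec_mulVec, Matrix.adjugate_mul, Matrix.smul_mulVec, Matrix.one_mulVec,
      Matrix.mulVec_neg, Pi.smul_apply, Pi.neg_apply, smul_eq_mul] at h'
    linear_combination M (b5 a) b7 * Ring.inverse_mul_cancel _ h45
      - Ring.inverse (M.submatrix b4 b5).det * h'
  · exact hM.h67.symm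
  · rfl

theorem elimS_eq_self (hM : SatisfiesS g M) (h23 : IsUnit (M b2 b3))
    (h45 : IsUnit (M.submatrix b4 b5).det) : elimS g M = M := by
  ext i j
  unfold elimS
  rw [linearElim_eq_self hM h23 h45]
  split
  · rw [hM.h14, sub_zero]
  · rw [hM.h16, sub_zero]
  · rw [hM.h36, sub_zero]
  · rw [hM.h38, sub_zero]
  · rw [hM.h58, sub_zero]
  · rfl

/-- Vanishing and invertibility conditions that make all denominators in `S` invertible, also
after elimination. -/
structure HasUnits (g : A) (M : Matrix (BlockIdx k m) (BlockIdx k m) A) : Prop where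
  unit_g : IsUnit g
  unit23 : IsUnit (M b2 b3)
  unit45 : IsUnit (M.submatrix b4 b5).det
  zero43 : ∀ a, M (b4 a) b3 = 0
  zero65 : ∀ a, M b6 (b5 a) = 0

namespace HasUnits

theorem det_cons (h : HasUnits g M) : IsUnit ((linearElim g M).submatrix
    (Fin.cons b2 b4 : Fin (k+1) → _) (Fin.cons b3 b5 : Fin (k+1) → _)).det := by
  rw [det_submatrix_cons_cons (linearElim g M) _ _ _ _ h.zero43]
  exact h.unit23.mul h.unit45

theorem det_snoc (h : HasUnits g M) : IsUnit ((linearElim g M).submatrix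
    (Fin.snoc b4 b6 : Fin (k+1) → _) (Fin.snoc b5 b7 : Fin (k+1) → _)).det := by
  rw [det_submatrix_snoc_snoc (linearElim g M) _ _ _ _ h.zero65]
  exact h.unit45.mul (h.unit_g.mul h.unit23)

theorem det23 (h : HasUnits g M) :
    IsUnit ((linearElim g M).submatrix ![b2] ![b3]).det := by
  rw [Matrix.det_fin_one]
  exact h.unit23

theorem det67 (h : HasUnits g M) :
    IsUnit ((linearElim g M).submatrix ![b6] ![b7]).det := by
  rw [Matrix.det_fin_one]
  exact h.unit_g.mul h.unit23

end HasUnits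

theorem map_linearElim (f : A →+* B) (h : HasUnits g M) :
    (linearElim g M).map f = linearElim (f g) (M.map f) := by
  ext i j
  rw [Matrix.map_apply]
  unfold linearElim
  have hdet : (((M.map f).submatrix b4 b5).det) = f (M.submatrix b4 b5).det := by
    rw [RingHom.map_det]; rfl
  have hadj : ((M.map f).submatrix b4 b5).adjugate = f.mapMatrix (M.submatrix b4 b5).adjugate := by
    rw [RingHom.map_adjugate]; rfl
  split <;> try simp only [map_zero, Matrix.map_apply, map_mul, map_neg, map_sum,
    map_ringInverse_of_isUnit f h.unit23]
  · split_ifs <;> simp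
  · split_ifs <;> simp
  · split_ifs <;> simp
  · split_ifs <;> simp
  · simp only [map_ringInverse_of_isUnit f h.unit45, hdet, hadj, Matrix.mulVec, dotProduct,
      map_sum, map_mul, RingHom.mapMatrix_apply, Matrix.map_apply]

theorem map_elimS (f : A →+* B) (h : HasUnits g M) :
    (elimS g M).map f = elimS (f g) (M.map f) := by
  ext i j
  rw [Matrix.map_apply]
  unfold elimS
  rw [← map_linearElim f h]
  split
  · rw [map_sub, map_borderedMinor _ _ _ _ _ _ h.det23]; rfl
  · rw [map_sub, map_borderedMinor _ _ _ _ _ _ h.det_cons]; rfl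
  · rw [map_sub, map_borderedMinor f (linearElim g M) b3 b4 b5 b6 h.unit45]; rfl
  · rw [map_sub, map_borderedMinor _ _ _ _ _ _ h.det_snoc]; rfl
  · rw [map_sub, map_borderedMinor _ _ _ _ _ _ h.det67]; rfl
  · rfl

theorem borderedMinor_eq_zero {ι : Type*} {N : ℕ} (M M' : Matrix ι ι A) (r : ι)
    (R C : Fin N → ι) (c : ι) (h : IsUnit (M.submatrix R C).det)
    (hRC : ∀ i j, M (R i) (C j) = M' (R i) (C j)) (hr : ∀ j, M r (C j) = M' r (C j))
    (hc : ∀ i, M (R i) c = M' (R i) c) (hM' : M' r c = M r c - borderedMinor M r R C c) :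
    borderedMinor M' r R C c = 0 := by
  linear_combination hM' - borderedMinor_sub_borderedMinor M M' r R C c h hRC hr hc

theorem satisfiesS_elimS (h : HasUnits g M) : SatisfiesS g (elimS g M) where
  h11 a b hab := if_pos hab
  h44 a b hab := if_pos hab
  h55 a b hab := if_pos hab
  h88 a b hab := if_pos hab
  h12 _ := rfl
  h34 _ := rfl
  h56 _ := rfl
  h78 _ := rfl
  h14 a b := by
    refine borderedMinor_eq_zero (linearElim g M) _ _ _ _ _ h.det23 ?_ ?_ ?_ rfl <;>
      simp [elimS]
  h16 a := by
    refine borderedMinor_eq_zero (linearElim g M) _ _ _ _ _ h.det_cons ?_ ?_ ?_ rfl <;>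
      simp [elimS, Fin.forall_fin_succ]
  h36 := by
    refine borderedMinor_eq_zero (linearElim g M) _ _ _ _ _ h.unit45 ?_ ?_ ?_ rfl <;>
      simp [elimS]
  h38 b := by
    refine borderedMinor_eq_zero (linearElim g M) _ _ _ _ _ h.det_snoc ?_ ?_ ?_ rfl <;>
      simp [elimS, Fin.forall_fin_succ']
  h58 a b := by
    refine borderedMinor_eq_zero (linearElim g M) _ _ _ _ _ h.det67 ?_ ?_ ?_ rfl <;>
      simp [elimS]
  h35 b := by
    simp only [elimS, linearElim]
    linear_combination -(∑ t, M b2 (b4 t) * M (b4 t) (b5 b))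
      * Ring.mul_inverse_cancel _ h.unit23
  h57 a := by
    have key : (M.submatrix b4 b5) *ᵥ ((M.submatrix b4 b5).adjugate *ᵥ
        fun s => M (b4 s) b6 * (g * M b2 b3)) =
        (M.submatrix b4 b5).det • fun s => M (b4 s) b6 * (g * M b2 b3) := by
      rw [Matrix.mulVec_mulVec, Matrix.mul_adjugate, Matrix.smul_mulVec, Matrix.one_mulVec]
    have key' := congrFun key a
    rw [Matrix.mulVec, dotProduct] at key'
    simp only [Matrix.submatrix_apply, Pi.smul_apply, smul_eq_mul] at key'
    have hcomm := fun x y => mul_left_comm x (-Ring.inverse (M.submatrix b4 b5).det) y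
    simp only [elimS, linearElim]
    simp_rw [hcomm, ← Finset.mul_sum]
    linear_combination -Ring.inverse (M.submatrix b4 b5).det * key'
      - M (b4 a) b6 * (g * M b2 b3) * Ring.inverse_mul_cancel _ h.unit45
  h67 := rfl

theorem elimS_apply_of_le {i j : BlockIdx k m} (hij : j.toFin ≤ i.toFin) :
    elimS g M i j = M i j := by
  unfold elimS linearElim
  rw [Fin.le_def] at hij
  split <;> try split
  all_goals first
    | rfl
    | (exfalso; simp only [toFin, r1, i2, i3, r4, c5, i6, i7, c8] at hij; omega)
    | (refine if_neg fun hlt => ?_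
       rw [Fin.lt_def] at hlt
       simp only [toFin, r1, r4, c5, c8] at hij; omega)

end Elimination

section Generic

variable (k m : ℕ)

/-- The generic matrix over `R'`, indexed by block indices. -/
def genLoc : Matrix (BlockIdx k m) (BlockIdx k m) (LocRing k m) :=
  ((genMat (2*(k+m+2))).map (toLoc k m)).submatrix toFin toFin

theorem genMat_apply_of_lt {n : ℕ} {i j : Fin n} (h : j < i) : genMat n i j = 0 := by
  simp [genMat, h.not_gt, h.ne']

theorem genMat_apply_self {n : ℕ} (i : Fin n) : genMat n i i = 1 := by
  simp [genMat]

theorem dPoly_ne_zero : dPoly k m ≠ 0 := by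
  have h : ∀ {i j : Fin (2*(k+m+2))}, i < j → genMat (2*(k+m+2)) i j ≠ 0 := by
    intro i j hij
    simp [genMat, hij]
  refine mul_ne_zero (mul_ne_zero (h (by simp [i2, i3])) ?_) (h (by simp [i6, i7]))
  intro h0
  have h1 := congrArg (MvPolynomial.eval fun p : {p : Fin (2*(k+m+2)) × Fin (2*(k+m+2)) //
    p.1 < p.2} => if (p.1.2 : ℕ) = p.1.1 + k then (1 : ℝ) else 0) h0
  rw [RingHom.map_det, map_zero] at h1
  refine one_ne_zero (α := ℝ) ((Matrix.det_one.symm.trans (congrArg Matrix.det ?_)).trans h1)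
  ext a b
  have hlt : r4 k m a < c5 k m b := by
    rw [Fin.lt_def]; simp only [r4, c5]; omega
  have hiff : (m + k + 2 + (b : ℕ) = m + 2 + a + k) ↔ a = b := by
    rw [Fin.ext_iff]; omega
  rw [RingHom.mapMatrix_apply, Matrix.map_apply, Matrix.submatrix_apply, genMat, Matrix.of_apply,
    dif_pos hlt, MvPolynomial.eval_X]
  simp only [r4, c5, hiff, Matrix.one_apply]

theorem isUnit_toLoc_dPoly : IsUnit (toLoc k m (dPoly k m)) :=
  IsLocalization.Away.algebraMap_isUnit (dPoly k m)

theorem genLoc_eq_zero {i j : BlockIdx k m} (h : j.toFin < i.toFin) : genLoc k m i j = 0 := by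
  simp [genLoc, genMat_apply_of_lt h]

theorem toLoc_dPoly : toLoc k m (dPoly k m)
    = genLoc k m b2 b3 * ((genLoc k m).submatrix b4 b5).det * genLoc k m b6 b7 := by
  have h : ((genLoc k m).submatrix b4 b5).det
      = toLoc k m ((genMat (2*(k+m+2))).submatrix (r4 k m) (c5 k m)).det :=
    (RingHom.map_det (toLoc k m) _).symm
  rw [h]
  exact ((toLoc k m).map_mul _ _).trans (congrArg (· * _) ((toLoc k m).map_mul _ _))

theorem isUnit_genLoc_b6_b7 : IsUnit (genLoc k m b6 b7) := by
  have h := isUnit_toLoc_dPoly k m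
  rw [toLoc_dPoly] at h
  exact isUnit_of_mul_isUnit_right h

theorem hasUnits_genLoc {g : LocRing k m} (hg : IsUnit g) : HasUnits g (genLoc k m) := by
  have h := isUnit_toLoc_dPoly k m
  rw [toLoc_dPoly] at h
  refine ⟨hg, ?_, ?_, fun a => ?_, fun a => ?_⟩
  · exact isUnit_of_mul_isUnit_left (isUnit_of_mul_isUnit_left h)
  · exact isUnit_of_mul_isUnit_right (isUnit_of_mul_isUnit_left h)
  · exact genLoc_eq_zero k m (by rw [Fin.lt_def]; simp only [toFin, i3, r4]; omega)
  · exact genLoc_eq_zero k m (by rw [Fin.lt_def]; simp only [toFin, i6, c5]; omega)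

theorem borderedMinor_genLoc {N : ℕ} (r : BlockIdx k m) (R C : Fin N → BlockIdx k m)
    (c : BlockIdx k m) :
    borderedMinor (genLoc k m) r R C c = (-1) ^ N
      * Ring.inverse (toLoc k m
          ((genMat (2*(k+m+2))).submatrix (toFin ∘ R) (toFin ∘ C)).det)
      * toLoc k m ((genMat (2*(k+m+2))).submatrix
          (Fin.cons r.toFin (toFin ∘ R) : Fin (N + 1) → _)
          (Fin.snoc (toFin ∘ C) c.toFin : Fin (N + 1) → _)).det := by
  rw [borderedMinor, RingHom.map_det, RingHom.map_det, ← Fin.comp_cons, ← Fin.comp_snoc]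
  rfl

theorem forall_mem_SPoly_iff {B : Type*} [CommRing B] (f : LocRing k m →+* B) {γ₁ γ₂ : ℝ}
    (hγ₁ : γ₁ ≠ 0) (hγ₂ : γ₂ ≠ 0) : (∀ x ∈ SPoly k m γ₁ γ₂, f x = 0) ↔
      SatisfiesS (f (toLoc k m (MvPolynomial.C (γ₁ / γ₂)))) ((genLoc k m).map f) := by
  have hu := hasUnits_genLoc k m (g := toLoc k m (MvPolynomial.C (γ₁ / γ₂)))
    (((Ne.isUnit (div_ne_zero hγ₁ hγ₂)).map MvPolynomial.C).map (toLoc k m))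
  have h67 := isUnit_genLoc_b6_b7 k m
  have hcons : IsUnit ((genLoc k m).submatrix (Fin.cons b2 b4 : Fin (k+1) → _)
      (Fin.cons b3 b5 : Fin (k+1) → _)).det := by
    rw [det_submatrix_cons_cons _ _ _ _ _ hu.zero43]
    exact hu.unit23.mul hu.unit45
  have hsnoc : IsUnit ((genLoc k m).submatrix (Fin.snoc b4 b6 : Fin (k+1) → _)
      (Fin.snoc b5 b7 : Fin (k+1) → _)).det := by
    rw [det_submatrix_snoc_snoc _ _ _ _ _ hu.zero65]
    exact hu.unit45.mul h67
  have e14 : ∀ a b, f (- Ring.inverse (toLoc k m (genMat (2*(k+m+2)) (i2 k m) (i3 k m)))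
      * toLoc k m ((genMat (2*(k+m+2))).submatrix
          ![r1 k m a, i2 k m] ![i3 k m, r4 k m b]).det)
      = borderedMinor ((genLoc k m).map f) (b1 a) ![b2] ![b3] (b4 b) := by
    intro a b
    rw [← map_borderedMinor f _ _ _ _ _ (by rw [Matrix.det_fin_one]; exact hu.unit23),
      ← neg_inverse_mul_det_fin_two, RingHom.map_det]
    congr 3
  have e58 : ∀ a b, f (- Ring.inverse (toLoc k m (genMat (2*(k+m+2)) (i6 k m) (i7 k m)))
      * toLoc k m ((genMat (2*(k+m+2))).submatrix
          ![c5 k m a, i6 k m] ![i7 k m, c8 k m b]).det)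
      = borderedMinor ((genLoc k m).map f) (b5 a) ![b6] ![b7] (b8 b) := by
    intro a b
    rw [← map_borderedMinor f _ _ _ _ _ (by rw [Matrix.det_fin_one]; exact h67),
      ← neg_inverse_mul_det_fin_two, RingHom.map_det]
    congr 3
  have e16 : ∀ a, f ((-1 : LocRing k m)^(k+1)
      * Ring.inverse (toLoc k m ((genMat (2*(k+m+2))).submatrix
          (Fin.cons (i2 k m) (r4 k m)) (Fin.cons (i3 k m) (c5 k m))).det)
      * toLoc k m ((genMat (2*(k+m+2))).submatrix
          (Fin.cons (r1 k m a) (Fin.cons (i2 k m) (r4 k m)))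
          (Fin.snoc (Fin.cons (i3 k m) (c5 k m)) (i6 k m))).det)
      = borderedMinor ((genLoc k m).map f) (b1 a) (Fin.cons b2 b4 : Fin (k+1) → _)
          (Fin.cons b3 b5 : Fin (k+1) → _) b6 := by
    intro a
    rw [← map_borderedMinor f _ _ _ _ _ hcons, borderedMinor_genLoc, Fin.comp_cons, Fin.comp_cons]
    rfl
  have e36 : f ((-1 : LocRing k m)^k
      * Ring.inverse (toLoc k m ((genMat (2*(k+m+2))).submatrix (r4 k m) (c5 k m)).det)
      * toLoc k m ((genMat (2*(k+m+2))).submatrix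
          (Fin.cons (i3 k m) (r4 k m)) (Fin.snoc (c5 k m) (i6 k m))).det)
      = borderedMinor ((genLoc k m).map f) b3 b4 b5 b6 := by
    rw [← map_borderedMinor f _ _ _ _ _ hu.unit45, borderedMinor_genLoc]
    rfl
  have e38 : ∀ b, f ((-1 : LocRing k m)^(k+1)
      * Ring.inverse (toLoc k m ((genMat (2*(k+m+2))).submatrix
          (Fin.snoc (r4 k m) (i6 k m)) (Fin.snoc (c5 k m) (i7 k m))).det)
      * toLoc k m ((genMat (2*(k+m+2))).submatrix
          (Fin.cons (i3 k m) (Fin.snoc (r4 k m) (i6 k m)))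
          (Fin.snoc (Fin.snoc (c5 k m) (i7 k m)) (c8 k m b))).det)
      = borderedMinor ((genLoc k m).map f) b3 (Fin.snoc b4 b6 : Fin (k+1) → _)
          (Fin.snoc b5 b7 : Fin (k+1) → _) (b8 b) := by
    intro b
    rw [← map_borderedMinor f _ _ _ _ _ hsnoc, borderedMinor_genLoc, Fin.comp_snoc, Fin.comp_snoc]
    rfl
  have e67 : f (toLoc k m (MvPolynomial.C γ₁ * genMat (2*(k+m+2)) (i2 k m) (i3 k m)
      - MvPolynomial.C γ₂ * genMat (2*(k+m+2)) (i6 k m) (i7 k m))) = 0 ↔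
      (genLoc k m).map f b6 b7
        = f (toLoc k m (MvPolynomial.C (γ₁ / γ₂))) * (genLoc k m).map f b2 b3 := by
    have hγ : toLoc k m (MvPolynomial.C γ₁)
        = toLoc k m (MvPolynomial.C γ₂) * toLoc k m (MvPolynomial.C (γ₁ / γ₂)) := by
      rw [← RingHom.map_mul, ← MvPolynomial.C_mul, mul_div_cancel₀ _ hγ₂]
    have hγu : IsUnit (f (toLoc k m (MvPolynomial.C γ₂))) :=
      (((Ne.isUnit hγ₂).map MvPolynomial.C).map (toLoc k m)).map f
    have h : f (toLoc k m (MvPolynomial.C γ₁ * genMat (2*(k+m+2)) (i2 k m) (i3 k m)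
        - MvPolynomial.C γ₂ * genMat (2*(k+m+2)) (i6 k m) (i7 k m)))
        = f (toLoc k m (MvPolynomial.C γ₂)) * (f (toLoc k m (MvPolynomial.C (γ₁ / γ₂)))
          * (genLoc k m).map f b2 b3 - (genLoc k m).map f b6 b7) := by
      simp only [map_sub, map_mul, hγ, genLoc, toFin, Matrix.map_apply, Matrix.submatrix_apply]
      ring
    rw [h, hγu.mul_right_eq_zero, sub_eq_zero, eq_comm]
  simp only [SPoly, Set.mem_union, or_imp, forall_and, Set.forall_mem_range,
    Set.mem_singleton_iff, forall_eq, Set.mem_ofPred_eq, forall_exists_index, and_imp,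
    Prod.forall, e14, e16, e36, e38, e58, e67]
  constructor
  · rintro ⟨⟨⟨⟨⟨⟨⟨⟨⟨⟨⟨⟨⟨⟨⟨h11, h44⟩, h55⟩, h88⟩, h12⟩, h14⟩, h16⟩, h34⟩, h36⟩, h38⟩, h56⟩,
      h58⟩, h78⟩, h35⟩, h57⟩, h67⟩
    refine ⟨fun a b h => h11 _ a b h rfl, fun a b h => h44 _ a b h rfl,
      fun a b h => h55 _ a b h rfl, fun a b h => h88 _ a b h rfl, h12, h14, h16, h34, h36, h38,
      h56, h58, h78, fun b => ?_, fun a => ?_, h67⟩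
    · simpa [genLoc, toFin] using h35 b
    · simpa [genLoc, toFin] using h57 a
  · intro h
    refine ⟨⟨⟨⟨⟨⟨⟨⟨⟨⟨⟨⟨⟨⟨⟨?_, ?_⟩, ?_⟩, ?_⟩, h.h12⟩, h.h14⟩, h.h16⟩, h.h34⟩, h.h36⟩, h.h38⟩,
      h.h56⟩, h.h58⟩, h.h78⟩, fun b => ?_⟩, fun a => ?_⟩, h.h67⟩
    · rintro _ a b hab rfl; exact h.h11 a b hab
    · rintro _ a b hab rfl; exact h.h44 a b hab
    · rintro _ a b hab rfl; exact h.h55 a b hab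
    · rintro _ a b hab rfl; exact h.h88 a b hab
    · simpa [genLoc, toFin] using h.h35 b
    · simpa [genLoc, toFin] using h.h57 a

/-- The evaluation `R → R'` that sends the generic matrix to its elimination. -/
def elimEval (g : LocRing k m) : CoordRing (2*(k+m+2)) →+* LocRing k m :=
  MvPolynomial.eval₂Hom ((toLoc k m).comp MvPolynomial.C)
    fun p => elimS g (genLoc k m) (equivFin.symm p.1.1) (equivFin.symm p.1.2)

theorem elimEval_genMat (g : LocRing k m) (i j : BlockIdx k m) :
    elimEval k m g (genMat (2*(k+m+2)) i.toFin j.toFin) = elimS g (genLoc k m) i j := by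
  rcases lt_or_ge i.toFin j.toFin with h | h
  · have hs : ∀ l : BlockIdx k m, equivFin.symm l.toFin = l := equivFin.symm_apply_apply
    simp [elimEval, genMat, h, hs]
  · rw [elimS_apply_of_le h, genLoc, Matrix.submatrix_apply, Matrix.map_apply]
    rcases h.lt_or_eq with h | h
    · rw [genMat_apply_of_lt h, map_zero, map_zero]
    · rw [h, genMat_apply_self, map_one, map_one]

theorem isUnit_elimEval_dPoly {g : LocRing k m} (hg : IsUnit g) :
    IsUnit (elimEval k m g (dPoly k m)) := by
  have hu := hasUnits_genLoc k m hg
  have hdet : elimEval k m g ((genMat (2*(k+m+2))).submatrix (r4 k m) (c5 k m)).det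
      = ((genLoc k m).submatrix b4 b5).det := by
    rw [RingHom.map_det]
    congr 1
    ext a b
    exact elimEval_genMat k m g (b4 a) (b5 b)
  have h : elimEval k m g (dPoly k m) = genLoc k m b2 b3
      * ((genLoc k m).submatrix b4 b5).det * (g * genLoc k m b2 b3) := by
    refine ((elimEval k m g).map_mul _ _).trans (congrArg₂ (· * ·)
      (((elimEval k m g).map_mul _ _).trans (congrArg₂ (· * ·) ?_ hdet)) ?_)
    · exact elimEval_genMat k m g b2 b3
    · exact elimEval_genMat k m g b6 b7
  rw [h]
  exact (hu.unit23.mul hu.unit45).mul (hg.mul hu.unit23)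

end Generic

/-- Proposition (even case), primality part: the ideal `I'` of the localization `R'` of the
coordinate ring of `UT(2(k+m+2),ℝ)` at the powers of `d` generated by the set `S` is prime. -/
theorem ideal_span_S_isPrime_even (k m : ℕ) (hk : 1 ≤ k) (hm : 1 ≤ m)
    (γ₁ γ₂ : ℝ) (hγ₁ : γ₁ ≠ 0) (hγ₂ : γ₂ ≠ 0) :
    (Ideal.span (SPoly k m γ₁ γ₂)).IsPrime := by
  set g : LocRing k m := toLoc k m (MvPolynomial.C (γ₁ / γ₂))
  have hg : IsUnit g :=
    ((Ne.isUnit (div_ne_zero hγ₁ hγ₂)).map MvPolynomial.C).map (toLoc k m)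
  have hu := hasUnits_genLoc k m hg
  let σ : LocRing k m →+* LocRing k m :=
    IsLocalization.Away.lift (dPoly k m) (isUnit_elimEval_dPoly k m hg)
  have hσ : ∀ x, σ (toLoc k m x) = elimEval k m g x :=
    IsLocalization.Away.lift_eq (dPoly k m) (isUnit_elimEval_dPoly k m hg)
  have hσC : ∀ r : ℝ, σ (toLoc k m (MvPolynomial.C r)) = toLoc k m (MvPolynomial.C r) := by
    intro r
    rw [hσ]
    exact MvPolynomial.eval₂Hom_C _ _ _
  have hσG : (genLoc k m).map σ = elimS g (genLoc k m) := by
    ext i j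
    exact (hσ _).trans (elimEval_genMat k m g i j)
  have hker : ∀ x ∈ SPoly k m γ₁ γ₂, σ x = 0 := by
    rw [forall_mem_SPoly_iff k m σ hγ₁ hγ₂, hσC, hσG]
    exact satisfiesS_elimS hu
  set I := Ideal.span (SPoly k m γ₁ γ₂)
  let q := Ideal.Quotient.mk I
  have hq : (elimS g (genLoc k m)).map q = (genLoc k m).map q := by
    have hS : SatisfiesS (q g) ((genLoc k m).map q) :=
      (forall_mem_SPoly_iff k m q hγ₁ hγ₂).1 fun x hx =>
        Ideal.Quotient.eq_zero_iff_mem.2 (Ideal.subset_span hx)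
    rw [map_elimS q hu]
    refine elimS_eq_self hS (hu.unit23.map q) ?_
    have h := hu.unit45.map q
    rwa [RingHom.map_det] at h
  have hqσ : q.comp σ = q := by
    refine IsLocalization.ringHom_ext (Submonoid.powers (dPoly k m)) ?_
    refine MvPolynomial.ringHom_ext (fun r => congrArg q (hσC r)) ?_
    rintro ⟨⟨i, j⟩, hij⟩
    obtain ⟨a, rfl⟩ := toFin_bijective.2 i
    obtain ⟨b, rfl⟩ := toFin_bijective.2 j
    have hX : genMat (2*(k+m+2)) a.toFin b.toFin = MvPolynomial.X ⟨(a.toFin, b.toFin), hij⟩ :=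
      dif_pos hij
    rw [← hX]
    exact (congrArg q ((hσ _).trans (elimEval_genMat k m g a b))).trans (congrFun₂ hq a b)
  have hIσ : I = RingHom.ker σ := by
    refine le_antisymm (Ideal.span_le.2 hker) fun x hx => ?_
    have h : q (σ x) = q x := DFunLike.congr_fun hqσ x
    rw [RingHom.mem_ker.1 hx, map_zero] at h
    exact Ideal.Quotient.eq_zero_iff_mem.1 h.symm
  have : IsDomain (LocRing k m) := IsLocalization.isDomain_localization
    (powers_le_nonZeroDivisors_of_noZeroDivisors (dPoly_ne_zero k m))
  rw [hIσ]
  exact RingHom.ker_isPrime σ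

end
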